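/- Let 𝔖₀ be a convex subset of 𝔖(ℋ) such that whenever ϱ ∈ 𝔖₀, ς is a state with cς ≤ ϱ for some c > 0 and [ϱ,ς] = 0, one has ς ∈ 𝔖₀. Let f be an LAA function on 𝔖₀ with control functions a_f, b_f, taking values in [0,+∞]. If either f(ρ) < +∞ or f̃([ρ−εI]₊) < +∞ for all ε ∈ (0,1], then f(σ) ≥ f̃([ρ−εI]₊) − 2a_f↑(ε) − b_f↑(ε) − a_f(1−r_ε), where r_ε := Tr[ρ−εI]₊, for any state σ ∈ 𝔖₀ such that [ρ,σ] = 0 and ½‖ρ−σ‖₁ ≤ ε ≤ 1; here f̃ is the homogeneous extension of f, a_f↑(ε) := a_f(ε) for ε ∈ [0,1/2] and a_f↑(ε) := a_f(1/2) for ε ∈ (1/2,1], and similarly for b_f↑. -/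

import Mathlib

open scoped ENNReal InnerProductSpace
open MeasureTheory

noncomputable section

namespace AFW

attribute [local instance] Classical.propDecidable

variable {𝓗 : Type*} [NormedAddCommGroup 𝓗] [InnerProductSpace ℂ 𝓗] [CompleteSpace 𝓗]

/-- Trace-type functional: on positive operators it is the trace; on self-adjoint
trace-class operators it is the trace norm `‖·‖₁`. -/
def trNorm (T : 𝓗 →L[ℂ] 𝓗) : ℝ≥0∞ :=
  ⨆ (s : Set 𝓗) (_ : Orthonormal ℂ (Subtype.val : s → 𝓗)),
    ∑' x : s, (‖⟪(x : 𝓗), T x⟫_ℂ‖₊ : ℝ≥0∞)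

/-- `ρ` is a quantum state: a positive (trace-class) operator with unit trace. -/
def IsState (ρ : 𝓗 →L[ℂ] 𝓗) : Prop := ρ.IsPositive ∧ trNorm ρ = 1

/-- `ρ ∧ εI` (spectral cut-off from above). -/
def cut (ρ : 𝓗 →L[ℂ] 𝓗) (ε : ℝ) : 𝓗 →L[ℂ] 𝓗 := cfc (fun x : ℝ => min x ε) ρ

/-- `[ρ − εI]₊`. -/
def cutAbove (ρ : 𝓗 →L[ℂ] 𝓗) (ε : ℝ) : 𝓗 →L[ℂ] 𝓗 := cfc (fun x : ℝ => max (x - ε) 0) ρ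

/-- positive part `[T]₊` of a self-adjoint operator. -/
def posP (T : 𝓗 →L[ℂ] 𝓗) : 𝓗 →L[ℂ] 𝓗 := cfc (fun x : ℝ => max x 0) T

/-- negative part `[T]₋` of a self-adjoint operator. -/
def negP (T : 𝓗 →L[ℂ] 𝓗) : 𝓗 →L[ℂ] 𝓗 := cfc (fun x : ℝ => max (-x) 0) T

def sqrtOp (T : 𝓗 →L[ℂ] 𝓗) : 𝓗 →L[ℂ] 𝓗 := cfc Real.sqrt T

def eta (x : ℝ) : ℝ := -(x * Real.log x)

/-- The von Neumann entropy `S(ρ) = Tr η(ρ)`, with values in `[0,+∞]`. -/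
def entropy (ρ : 𝓗 →L[ℂ] 𝓗) : ℝ≥0∞ := trNorm (cfc eta ρ)

/-- Homogeneous extension `S̃` of the von Neumann entropy to the positive cone. -/
def entExt (ρ : 𝓗 →L[ℂ] 𝓗) : ℝ≥0∞ :=
  if ρ = 0 then 0 else trNorm ρ * entropy ((trNorm ρ).toReal⁻¹ • ρ)

def binEnt (p : ℝ) : ℝ := eta p + eta (1 - p)

def binEntUp (x : ℝ) : ℝ := if x ≤ 1 / 2 then binEnt x else Real.log 2

def etaUp (x : ℝ) : ℝ := if x ≤ (Real.exp 1)⁻¹ then eta x else (Real.exp 1)⁻¹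

/-- nondecreasing modification `a↑` used for control functions. -/
def up (a : ℝ → ℝ) (x : ℝ) : ℝ := if x ≤ 1 / 2 then a x else a (1 / 2)

/-- Control functions for LAA functions. -/
structure ControlPair (a b : ℝ → ℝ) : Prop where
  conta : ContinuousOn a (Set.Icc 0 1)
  contb : ContinuousOn b (Set.Icc 0 1)
  zeroa : a 0 = 0
  zerob : b 0 = 0
  cva : ConcaveOn ℝ (Set.Icc 0 (1 / 2)) a
  cvb : ConcaveOn ℝ (Set.Icc 0 (1 / 2)) b
  mona : MonotoneOn a (Set.Icc 0 (1 / 2))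
  monb : MonotoneOn b (Set.Icc 0 (1 / 2))

/-- `f` is locally almost affine on `S0` with control functions `a`, `b`. -/
def IsLAA (S0 : Set (𝓗 →L[ℂ] 𝓗)) (f : (𝓗 →L[ℂ] 𝓗) → EReal) (a b : ℝ → ℝ) : Prop :=
  ∀ ρ ∈ S0, ∀ σ ∈ S0, ∀ p : ℝ, 0 ≤ p → p ≤ 1 →
    ((p : EReal) * f ρ + ((1 - p : ℝ) : EReal) * f σ) - ((a p : ℝ) : EReal)
        ≤ f (p • ρ + (1 - p) • σ) ∧
      f (p • ρ + (1 - p) • σ)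
        ≤ ((p : EReal) * f ρ + ((1 - p : ℝ) : EReal) * f σ) + ((b p : ℝ) : EReal)

/-- Homogeneous extension of `f` to the cone generated by its domain. -/
def homExt (f : (𝓗 →L[ℂ] 𝓗) → EReal) (T : 𝓗 →L[ℂ] 𝓗) : EReal :=
  if T = 0 then 0 else (trNorm T : EReal) * f ((trNorm T).toReal⁻¹ • T)

/-- The barycenter `Ω(μ)` of the family `w` with respect to `μ`. -/
def Omega {X : Type*} [MeasurableSpace X] (w : X → 𝓗 →L[ℂ] 𝓗) (μ : Measure X) :
    𝓗 →L[ℂ] 𝓗 := ∫ x, w x ∂μ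

/-- The quasi-classical set of states generated by `(X, 𝔉, w)`. -/
def QSet {X : Type*} [MeasurableSpace X] (w : X → 𝓗 →L[ℂ] 𝓗) : Set (𝓗 →L[ℂ] 𝓗) :=
  {ρ | ∃ μ : Measure X, IsProbabilityMeasure μ ∧ ρ = Omega w μ}

/-- Total variation distance between measures. -/
def TV {X : Type*} [MeasurableSpace X] (μ ν : Measure X) : ℝ≥0∞ :=
  ⨆ (A : Set X) (_ : MeasurableSet A), (μ A - ν A) ⊔ (ν A - μ A)

/-- `Tr H ρ` for a positive operator `H = Σ h_k |τ_k⟩⟨τ_k|` given by discrete spectral data. -/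
def energy (h : ℕ → ℝ) (τ : ℕ → 𝓗) (ρ : 𝓗 →L[ℂ] 𝓗) : ℝ≥0∞ :=
  if LinearMap.range (ρ : 𝓗 →ₗ[ℂ] 𝓗) ≤ (Submodule.span ℂ (Set.range τ)).topologicalClosure
  then ∑' k, ENNReal.ofReal (h k * (⟪τ k, ρ (τ k)⟫_ℂ).re)
  else ⊤

/-- A positive operator with discrete spectral representation `Σ h_k |τ_k⟩⟨τ_k|`
(nondecreasing nonnegative eigenvalue sequence, orthonormal eigenvectors). -/
structure DiscreteOp (h : ℕ → ℝ) (τ : ℕ → 𝓗) : Prop where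
  ortho : Orthonormal ℂ τ
  nonneg : ∀ k, 0 ≤ h k
  mono : Monotone h

/-- The Gibbs condition `Tr e^{−βH} < ∞` for all `β > 0`. -/
def GibbsCondition (h : ℕ → ℝ) : Prop := ∀ β : ℝ, 0 < β → Summable fun k => Real.exp (-β * h k)

/-- `F_H(E) = sup { S(ρ) : Tr Hρ ≤ E }`. -/
def FH (h : ℕ → ℝ) (τ : ℕ → 𝓗) (E : ℝ≥0∞) : ℝ≥0∞ :=
  ⨆ (ϑ : 𝓗 →L[ℂ] 𝓗) (_ : IsState ϑ) (_ : energy h τ ϑ ≤ E), entropy ϑ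

/-- `Tr(ρ M)` for positive `ρ`, `M`, computed as `Tr(√ρ M √ρ)`. -/
def trPair (ρ M : 𝓗 →L[ℂ] 𝓗) : ℝ≥0∞ := trNorm (sqrtOp ρ * M * sqrtOp ρ)

/-- classical relative entropy of two finite tuples. -/
def klFin {n : ℕ} (p q : Fin n → ℝ) : ℝ≥0∞ :=
  if ∀ i, q i = 0 → p i = 0 then
    ENNReal.ofReal (∑ i, if p i = 0 then 0 else p i * Real.log (p i / q i))
  else ⊤

/-- The quantum relative entropy `D(ρ‖σ)`, realized as the supremum of classical
relative entropies of outcome distributions over all finite quantum measurements. -/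
def relEnt (ρ σ : 𝓗 →L[ℂ] 𝓗) : ℝ≥0∞ :=
  ⨆ (n : ℕ) (M : Fin n → 𝓗 →L[ℂ] 𝓗) (_ : ∀ i, (M i).IsPositive) (_ : ∑ i, M i = 1),
    klFin (fun i => (trPair ρ (M i)).toReal) (fun i => (trPair σ (M i)).toReal)

/-- rank of an operator (junk value `0` if infinite). -/
def opRank (T : 𝓗 →L[ℂ] 𝓗) : ℕ := Module.finrank ℂ (LinearMap.range (T : 𝓗 →ₗ[ℂ] 𝓗))

/-- a positive trace-preserving linear map (such as a partial trace). -/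
def IsMarginal {𝓚 : Type*} [NormedAddCommGroup 𝓚] [InnerProductSpace ℂ 𝓚] [CompleteSpace 𝓚]
    (Λ : (𝓗 →L[ℂ] 𝓗) →ₗ[ℂ] (𝓚 →L[ℂ] 𝓚)) : Prop :=
  (∀ T : 𝓗 →L[ℂ] 𝓗, T.IsPositive → (Λ T).IsPositive) ∧
  (∀ T : 𝓗 →L[ℂ] 𝓗, T.IsPositive → trNorm (Λ T) = trNorm T)

end AFW

namespace AFW

section Trace

variable {𝓗 : Type*} [NormedAddCommGroup 𝓗] [InnerProductSpace ℂ 𝓗]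

lemma coe_nnnorm_inner_of_nonneg {T : 𝓗 →L[ℂ] 𝓗} (hT : 0 ≤ T) (x : 𝓗) :
    ((‖⟪x, T x⟫_ℂ‖₊ : NNReal) : ℝ≥0∞) = ENNReal.ofReal (⟪x, T x⟫_ℂ).re := by
  have h := (ContinuousLinearMap.nonneg_iff_isPositive T).1 hT |>.inner_nonneg_right x
  rw [← enorm_eq_nnnorm, ← ofReal_norm, Complex.re_eq_norm.2 h]

lemma hasSum_norm_inner_sq {ι : Type*} (b : HilbertBasis ι ℂ 𝓗) (x : 𝓗) :
    HasSum (fun i => ‖⟪b i, x⟫_ℂ‖ ^ 2) (‖x‖ ^ 2) := by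
  have h := Complex.hasSum_re (b.hasSum_inner_mul_inner x x)
  have e : (⟪x, x⟫_ℂ).re = ‖x‖ ^ 2 := inner_self_eq_norm_sq (𝕜 := ℂ) x
  rw [e] at h
  refine h.congr_fun ?_
  intro i
  rw [← inner_conj_symm x (b i), mul_comm, Complex.mul_conj, Complex.normSq_eq_norm_sq,
    Complex.ofReal_re]

variable [CompleteSpace 𝓗]

lemma ofReal_re_inner_eq_tsum {ι : Type*} (b : HilbertBasis ι ℂ 𝓗) {T : 𝓗 →L[ℂ] 𝓗} (hT : 0 ≤ T)
    (x : 𝓗) : ENNReal.ofReal (⟪x, T x⟫_ℂ).re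
      = ∑' i, ENNReal.ofReal (‖⟪b i, CFC.sqrt T x⟫_ℂ‖ ^ 2) := by
  have hS := (ContinuousLinearMap.nonneg_iff_isPositive _).1 (CFC.sqrt_nonneg T)
  have e : T x = CFC.sqrt T (CFC.sqrt T x) := by
    rw [← mul_apply_eq_comp, CFC.sqrt_mul_sqrt_self T hT]
  have h := hasSum_norm_inner_sq b (CFC.sqrt T x)
  rw [← ENNReal.ofReal_tsum_of_nonneg (fun _ => by positivity) h.summable, h.tsum_eq, e,
    ← hS.inner_left_eq_inner_right, ← inner_self_eq_norm_sq (𝕜 := ℂ)]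
  rfl

/-- The trace of a positive operator does not depend on the Hilbert basis. -/
lemma tsum_re_inner_eq {ι κ : Type*} (b : HilbertBasis ι ℂ 𝓗) (c : HilbertBasis κ ℂ 𝓗)
    {T : 𝓗 →L[ℂ] 𝓗} (hT : 0 ≤ T) :
    ∑' i, ENNReal.ofReal (⟪b i, T (b i)⟫_ℂ).re = ∑' k, ENNReal.ofReal (⟪c k, T (c k)⟫_ℂ).re := by
  have hS := (ContinuousLinearMap.nonneg_iff_isPositive _).1 (CFC.sqrt_nonneg T)
  simp_rw [ofReal_re_inner_eq_tsum c hT (b _), ofReal_re_inner_eq_tsum b hT (c _)]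
  rw [ENNReal.tsum_comm]
  refine tsum_congr fun k => tsum_congr fun i => ?_
  rw [← hS.inner_left_eq_inner_right, norm_inner_symm]

lemma trNorm_eq_tsum {w : Set 𝓗} (b : HilbertBasis w ℂ 𝓗) {T : 𝓗 →L[ℂ] 𝓗} (hT : 0 ≤ T) :
    trNorm T = ∑' i, ENNReal.ofReal (⟪b i, T (b i)⟫_ℂ).re := by
  unfold trNorm
  simp_rw [coe_nnnorm_inner_of_nonneg hT]
  refine le_antisymm (iSup₂_le fun s hs => ?_) ?_
  · obtain ⟨w', b', hsw, hb'⟩ := hs.exists_hilbertBasis_extension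
    rw [tsum_re_inner_eq b b' hT, hb']
    exact ENNReal.tsum_mono_subtype (fun x : 𝓗 => ENNReal.ofReal (⟪x, T x⟫_ℂ).re) hsw
  · obtain ⟨w', b', hb'⟩ := exists_hilbertBasis ℂ 𝓗
    rw [tsum_re_inner_eq b b' hT]
    refine le_iSup₂_of_le w' (hb' ▸ b'.orthonormal) ?_
    rw [hb']

lemma trNorm_add {A B : 𝓗 →L[ℂ] 𝓗} (hA : 0 ≤ A) (hB : 0 ≤ B) :
    trNorm (A + B) = trNorm A + trNorm B := by
  obtain ⟨w, b, -⟩ := exists_hilbertBasis ℂ 𝓗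
  rw [trNorm_eq_tsum b hA, trNorm_eq_tsum b hB, trNorm_eq_tsum b (add_nonneg hA hB),
    ← ENNReal.tsum_add]
  refine tsum_congr fun i => ?_
  have hAi : 0 ≤ (⟪b i, A (b i)⟫_ℂ).re :=
    ((ContinuousLinearMap.nonneg_iff_isPositive A).1 hA).re_inner_nonneg_right _
  have hBi : 0 ≤ (⟪b i, B (b i)⟫_ℂ).re :=
    ((ContinuousLinearMap.nonneg_iff_isPositive B).1 hB).re_inner_nonneg_right _
  rw [← ENNReal.ofReal_add hAi hBi]
  simp

lemma trNorm_smul {T : 𝓗 →L[ℂ] 𝓗} (hT : 0 ≤ T) {c : ℝ} (hc : 0 ≤ c) :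
    trNorm (c • T) = ENNReal.ofReal c * trNorm T := by
  obtain ⟨w, b, -⟩ := exists_hilbertBasis ℂ 𝓗
  rw [trNorm_eq_tsum b hT, trNorm_eq_tsum b (smul_nonneg hc hT), ← ENNReal.tsum_mul_left]
  refine tsum_congr fun i => ?_
  rw [← ENNReal.ofReal_mul hc]
  simp [inner_smul_right_eq_smul]

lemma trNorm_eq_zero {T : 𝓗 →L[ℂ] 𝓗} (hT : 0 ≤ T) (h : trNorm T = 0) : T = 0 := by
  obtain ⟨w, b, -⟩ := exists_hilbertBasis ℂ 𝓗
  have hS := (ContinuousLinearMap.nonneg_iff_isPositive _).1 (CFC.sqrt_nonneg T)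
  rw [trNorm_eq_tsum b hT, ENNReal.tsum_eq_zero] at h
  have hs : CFC.sqrt T = 0 := by
    ext x
    refine b.repr.injective ?_
    ext i
    have hi := h i
    rw [ofReal_re_inner_eq_tsum b hT, ENNReal.tsum_eq_zero] at hi
    have hz : CFC.sqrt T (b i) = 0 := by
      refine b.repr.injective ?_
      ext j
      have := hi j
      simp only [ENNReal.ofReal_eq_zero] at this
      have h0 : ‖⟪b j, CFC.sqrt T (b i)⟫_ℂ‖ = 0 := by nlinarith [norm_nonneg ⟪b j, CFC.sqrt T (b i)⟫_ℂ]
      simpa [b.repr_apply_apply] using h0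
    rw [b.repr_apply_apply, ← hS.inner_left_eq_inner_right, hz]
    simp
  rw [← CFC.sqrt_mul_sqrt_self T hT, hs, mul_zero]

lemma hasSum_re_inner {w : Set 𝓗} (b : HilbertBasis w ℂ 𝓗) {ρ : 𝓗 →L[ℂ] 𝓗} (hρ : IsState ρ) :
    HasSum (fun i => (⟪b i, ρ (b i)⟫_ℂ).re) 1 := by
  have h := trNorm_eq_tsum b ((ContinuousLinearMap.nonneg_iff_isPositive ρ).2 hρ.1)
  have h0 : ∀ i, 0 ≤ (⟪b i, ρ (b i)⟫_ℂ).re := fun i => hρ.1.re_inner_nonneg_right _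
  have hs := ENNReal.hasSum_toReal (f := fun i => ENNReal.ofReal (⟪b i, ρ (b i)⟫_ℂ).re)
    (by rw [← h, hρ.2]; simp)
  rw [← ENNReal.tsum_toReal_eq (fun _ => ENNReal.ofReal_ne_top), ← h, hρ.2] at hs
  simpa [ENNReal.toReal_ofReal (h0 _)] using hs

/-- Half the trace distance of two states bounds the quadratic form of their difference. -/
lemma re_inner_sub_le_of_norm_eq_one {ρ σ : 𝓗 →L[ℂ] 𝓗} (hρ : IsState ρ) (hσ : IsState σ) {ε : ℝ} (hε : 0 ≤ ε)
    (hdist : trNorm (ρ - σ) ≤ ENNReal.ofReal (2 * ε)) {x : 𝓗} (hx : ‖x‖ = 1) :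
    (⟪x, (ρ - σ) x⟫_ℂ).re ≤ ε := by
  have ho : Orthonormal ℂ (Subtype.val : ({x} : Set 𝓗) → 𝓗) := by
    refine ⟨fun i => ?_, fun i j hij => absurd (Subsingleton.elim i j) hij⟩
    rw [show (i : 𝓗) = x from i.2, hx]
  obtain ⟨w, b, hsw, hb⟩ := ho.exists_hilbertBasis_extension
  have hxw : x ∈ w := hsw rfl
  set D := ρ - σ with hD
  set g : w → ℝ := fun i => (⟪b i, D (b i)⟫_ℂ).re with hg
  have hgsum : HasSum g 0 := by
    simpa [hg, hD, inner_sub_right] using (hasSum_re_inner b hρ).sub (hasSum_re_inner b hσ)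
  have habs : ∑' i, ENNReal.ofReal |g i| ≤ ENNReal.ofReal (2 * ε) := by
    refine le_trans ?_ hdist
    refine le_iSup₂_of_le w (hb ▸ b.orthonormal) (ENNReal.tsum_le_tsum fun i => ?_)
    rw [← enorm_eq_nnnorm, ← ofReal_norm, ← congrFun hb i]
    exact ENNReal.ofReal_le_ofReal (Complex.abs_re_le_norm _)
  have hsummable : Summable fun i => |g i| := hgsum.summable.abs
  rw [← ENNReal.ofReal_tsum_of_nonneg (fun _ => abs_nonneg _) hsummable,
    ENNReal.ofReal_le_ofReal_iff (by positivity)] at habs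
  have h1 := hsummable.tsum_add hgsum.summable
  rw [hgsum.tsum_eq, add_zero] at h1
  have h2 := (hsummable.add hgsum.summable).le_tsum (⟨x, hxw⟩ : w)
    (fun j _ => by linarith [neg_abs_le (g j)])
  have h3 : g ⟨x, hxw⟩ = (⟪x, D x⟫_ℂ).re := by simp only [hg, hb]
  rw [← h3]
  linarith [le_abs_self (g ⟨x, hxw⟩)]

lemma re_inner_sub_le_mul_norm_sq {ρ σ : 𝓗 →L[ℂ] 𝓗} (hρ : IsState ρ) (hσ : IsState σ) {ε : ℝ} (hε : 0 ≤ ε)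
    (hdist : trNorm (ρ - σ) ≤ ENNReal.ofReal (2 * ε)) (x : 𝓗) :
    (⟪x, (ρ - σ) x⟫_ℂ).re ≤ ε * ‖x‖ ^ 2 := by
  rcases eq_or_ne x 0 with rfl | hx
  · simp
  have hn : ‖x‖ ≠ 0 := norm_ne_zero_iff.2 hx
  have h := re_inner_sub_le_of_norm_eq_one hρ hσ hε hdist (x := ((‖x‖⁻¹ : ℝ) : ℂ) • x)
    (by rw [norm_smul]; simp [hn])
  rw [map_smul, inner_smul_left, inner_smul_right, Complex.conj_ofReal, ← mul_assoc,
    ← Complex.ofReal_mul, Complex.re_ofReal_mul] at h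
  have hp : 0 < ‖x‖ ^ 2 := by positivity
  have := mul_le_mul_of_nonneg_right h hp.le
  calc _ = _ := ?_
    _ ≤ _ := this
  field_simp

end Trace

section Order

variable {𝓗 : Type*} [NormedAddCommGroup 𝓗] [InnerProductSpace ℂ 𝓗] [CompleteSpace 𝓗]

/-- If `P - N ≤ σ` with `σ ≥ 0` commuting with `P ≥ 0` and `P N = 0`, then `P ≤ σ`. -/
lemma le_of_sub_le_of_mul_eq_zero {P N σ : 𝓗 →L[ℂ] 𝓗} (hP : 0 ≤ P) (hN : IsSelfAdjoint N)
    (hσ : 0 ≤ σ) (hPN : P * N = 0) (hcomm : P * σ = σ * P)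
    (h : ∀ x, (⟪x, (P - N) x⟫_ℂ).re ≤ (⟪x, σ x⟫_ℂ).re) : P ≤ σ := by
  have hPp := (ContinuousLinearMap.nonneg_iff_isPositive P).1 hP
  have hσp := (ContinuousLinearMap.nonneg_iff_isPositive σ).1 hσ
  have hsa : IsSelfAdjoint (σ - P) := hσp.isSelfAdjoint.sub hPp.isSelfAdjoint
  rw [ContinuousLinearMap.le_def, ContinuousLinearMap.isPositive_def]
  refine ⟨hsa.isSymmetric, fun x => ?_⟩
  let K : Submodule ℂ 𝓗 := LinearMap.ker (P : 𝓗 →ₗ[ℂ] 𝓗)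
  have hK : ∀ v, v ∈ K ↔ P v = 0 := fun v => Iff.rfl
  have hKc : IsClosed (K : Set 𝓗) := P.isClosed_ker
  have : CompleteSpace K := hKc.completeSpace_coe
  obtain ⟨v, hv, u, hu, rfl⟩ := K.exists_add_mem_mem_orthogonal x
  have hNu : N u = 0 := by
    have hm : N (N u) ∈ K := by
      rw [hK, ← mul_apply_eq_comp, hPN]; rfl
    have h0 : ⟪N (N u), u⟫_ℂ = 0 := hu _ hm
    rw [show ⟪N (N u), u⟫_ℂ = ⟪N u, N u⟫_ℂ from hN.isSymmetric (N u) u] at h0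
    exact inner_self_eq_zero.1 h0
  have hXv : (σ - P) v ∈ K := by
    rw [hK]
    have : P (σ v) = σ (P v) := by
      rw [← mul_apply_eq_comp, hcomm]; rfl
    simp [this, (hK v).1 hv]
  have c1 : ⟪(σ - P) v, u⟫_ℂ = 0 := hu _ hXv
  have c2 : ⟪(σ - P) u, v⟫_ℂ = 0 := by
    rw [show ⟪(σ - P) u, v⟫_ℂ = ⟪u, (σ - P) v⟫_ℂ from hsa.isSymmetric u v]
    exact inner_eq_zero_symm.1 c1
  have hu1 := h u
  have hv1 : 0 ≤ (⟪v, σ v⟫_ℂ).re := hσp.re_inner_nonneg_right v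
  have e1 : (⟪(σ - P) v, v⟫_ℂ).re = (⟪v, σ v⟫_ℂ).re := by
    rw [sub_apply, (hK v).1 hv, sub_zero, hσp.inner_left_eq_inner_right]
  have e2 : (⟪(σ - P) u, u⟫_ℂ).re = (⟪u, σ u⟫_ℂ).re - (⟪u, (P - N) u⟫_ℂ).re := by
    rw [show ⟪(σ - P) u, u⟫_ℂ = ⟪u, (σ - P) u⟫_ℂ from hsa.isSymmetric u u]
    simp [hNu]
  have goal : 0 ≤ (⟪(σ - P) (v + u), v + u⟫_ℂ).re := by
    rw [map_add, inner_add_left, inner_add_right, inner_add_right, c1, c2]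
    simp only [add_zero, zero_add, Complex.add_re]
    linarith
  exact goal

lemma cutAbove_nonneg (ρ : 𝓗 →L[ℂ] 𝓗) (ε : ℝ) : 0 ≤ cutAbove ρ ε :=
  cfc_nonneg fun _ _ => le_max_right _ _

lemma cutAbove_le_self {ρ : 𝓗 →L[ℂ] 𝓗} (hρ : 0 ≤ ρ) {ε : ℝ} (hε : 0 ≤ ε) : cutAbove ρ ε ≤ ρ := by
  have hsa : IsSelfAdjoint ρ := hρ.isSelfAdjoint
  conv_rhs => rw [← cfc_id' ℝ ρ]
  refine cfc_mono fun x hx => ?_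
  have : 0 ≤ x := spectrum_nonneg_of_nonneg hρ hx
  exact max_le (by linarith) this

lemma cutAbove_le_of_trNorm_sub_le {ρ σ : 𝓗 →L[ℂ] 𝓗} (hρ : IsState ρ) (hσ : IsState σ)
    (hcomm : ρ * σ = σ * ρ) {ε : ℝ} (hε : 0 ≤ ε)
    (hdist : trNorm (ρ - σ) ≤ ENNReal.ofReal (2 * ε)) : cutAbove ρ ε ≤ σ := by
  have hsa : IsSelfAdjoint ρ := hρ.1.isSelfAdjoint
  let N : 𝓗 →L[ℂ] 𝓗 := cfc (fun x : ℝ => max (ε - x) 0) ρ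
  have hPN : cutAbove ρ ε * N = 0 := by
    rw [cutAbove, ← cfc_mul _ _ ρ]
    have : (fun x : ℝ => max (x - ε) 0 * max (ε - x) 0) = fun _ => 0 := by
      ext x
      rcases le_total x ε with h | h
      · rw [max_eq_right (by linarith : x - ε ≤ 0), zero_mul]
      · rw [max_eq_right (by linarith : ε - x ≤ 0), mul_zero]
    rw [this]
    simp
  have hsub : cutAbove ρ ε - N = ρ - algebraMap ℝ _ ε := by
    rw [cutAbove, ← cfc_sub _ _ ρ]
    have : (fun x : ℝ => max (x - ε) 0 - max (ε - x) 0) = fun x => x - ε := by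
      ext x
      rcases le_total x ε with h | h
      · rw [max_eq_right (by linarith : x - ε ≤ 0), max_eq_left (by linarith : 0 ≤ ε - x)]; ring
      · rw [max_eq_right (by linarith : ε - x ≤ 0), max_eq_left (by linarith : 0 ≤ x - ε)]; ring
    rw [this, cfc_sub _ _ ρ, cfc_id' ℝ ρ, cfc_const ε ρ]
  refine le_of_sub_le_of_mul_eq_zero (N := N) (cutAbove_nonneg ρ ε) (cfc_predicate _ _)
    ((ContinuousLinearMap.nonneg_iff_isPositive σ).2 hσ.1) hPN (Commute.cfc_real hcomm _) fun x => ?_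
  have h := re_inner_sub_le_mul_norm_sq hρ hσ hε hdist x
  have e : (⟪x, (algebraMap ℝ (𝓗 →L[ℂ] 𝓗) ε) x⟫_ℂ).re = ε * ‖x‖ ^ 2 := by
    rw [Algebra.algebraMap_eq_smul_one, smul_apply,
      one_apply_eq_self, inner_smul_right_eq_smul, Complex.smul_re, smul_eq_mul,
      show (⟪x, x⟫_ℂ).re = ‖x‖ ^ 2 from inner_self_eq_norm_sq (𝕜 := ℂ) x]
  rw [hsub, sub_apply, inner_sub_right, Complex.sub_re, e]
  rw [sub_apply, inner_sub_right, Complex.sub_re] at h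
  linarith

/-- Normalization of an operator dominated by a state of an admissible set. -/
lemma exists_mem_eq_smul {S0 : Set (𝓗 →L[ℂ] 𝓗)}
    (hSprop : ∀ ϱ ∈ S0, ∀ ς : 𝓗 →L[ℂ] 𝓗, IsState ς →
      (∃ c : ℝ, 0 < c ∧ c • ς ≤ ϱ) → ϱ * ς = ς * ϱ → ς ∈ S0)
    (f : (𝓗 →L[ℂ] 𝓗) → EReal) {ϱ T : 𝓗 →L[ℂ] 𝓗} (hϱ : ϱ ∈ S0) (hT : 0 ≤ T) (hle : T ≤ ϱ)
    (hcomm : ϱ * T = T * ϱ) (hfin : trNorm T ≠ ⊤) :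
    ∃ ν ∈ S0, T = (trNorm T).toReal • ν ∧ homExt f T = ((trNorm T).toReal : EReal) * f ν := by
  by_cases h0 : T = 0
  · have hz : trNorm (0 : 𝓗 →L[ℂ] 𝓗) = 0 := by simp [trNorm]
    exact ⟨ϱ, hϱ, by simp [h0, hz], by simp [h0, homExt, hz]⟩
  have ht0 : trNorm T ≠ 0 := fun h => h0 (trNorm_eq_zero hT h)
  have ht : 0 < (trNorm T).toReal := ENNReal.toReal_pos ht0 hfin
  have hT' : T = (trNorm T).toReal • (trNorm T).toReal⁻¹ • T := (smul_inv_smul₀ ht.ne' T).symm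
  refine ⟨(trNorm T).toReal⁻¹ • T, hSprop ϱ hϱ _ ⟨?_, ?_⟩ ⟨_, ht, ?_⟩ ?_, hT', ?_⟩
  · exact (ContinuousLinearMap.nonneg_iff_isPositive _).1 (smul_nonneg (inv_nonneg.2 ht.le) hT)
  · rw [trNorm_smul hT (inv_nonneg.2 ht.le), ENNReal.ofReal_inv_of_pos ht,
      ENNReal.ofReal_toReal hfin, ENNReal.inv_mul_cancel ht0 hfin]
  · rwa [← hT']
  · rw [mul_smul_comm, smul_mul_assoc, hcomm]
  · rw [homExt, if_neg h0, ← EReal.coe_ennreal_toReal hfin]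

end Order

lemma ControlPair.up_nonneg {a b : ℝ → ℝ} (hab : ControlPair a b) {x : ℝ} (hx : 0 ≤ x) :
    0 ≤ up a x ∧ 0 ≤ up b x := by
  unfold up
  split_ifs with h
  · exact ⟨hab.zeroa ▸ hab.mona ⟨le_rfl, by norm_num⟩ ⟨hx, h⟩ hx,
      hab.zerob ▸ hab.monb ⟨le_rfl, by norm_num⟩ ⟨hx, h⟩ hx⟩
  · exact ⟨hab.zeroa ▸ hab.mona ⟨le_rfl, by norm_num⟩ ⟨by norm_num, le_rfl⟩ (by norm_num),
      hab.zerob ▸ hab.monb ⟨le_rfl, by norm_num⟩ ⟨by norm_num, le_rfl⟩ (by norm_num)⟩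

/-- advanced commutative AFW lemma, part B: local lower bound. -/
theorem stmt2
    {𝓗 : Type*} [NormedAddCommGroup 𝓗] [InnerProductSpace ℂ 𝓗] [CompleteSpace 𝓗]
    (S0 : Set (𝓗 →L[ℂ] 𝓗)) (hS0 : S0 ⊆ {ϱ | IsState ϱ}) (hconv : Convex ℝ S0)
    (hSprop : ∀ ϱ ∈ S0, ∀ ς : 𝓗 →L[ℂ] 𝓗, IsState ς →
      (∃ c : ℝ, 0 < c ∧ c • ς ≤ ϱ) → ϱ * ς = ς * ϱ → ς ∈ S0)
    (f : (𝓗 →L[ℂ] 𝓗) → EReal) (a b : ℝ → ℝ) (hab : ControlPair a b)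
    (hnonneg : ∀ ϱ ∈ S0, 0 ≤ f ϱ) (hLAA : IsLAA S0 f a b)
    (ρ : 𝓗 →L[ℂ] 𝓗) (hρ : ρ ∈ S0)
    (hfin : f ρ ≠ ⊤ ∨ ∀ ε' ∈ Set.Ioc (0 : ℝ) 1, homExt f (cutAbove ρ ε') ≠ ⊤)
    (σ : 𝓗 →L[ℂ] 𝓗) (hσ : σ ∈ S0) (hcomm : ρ * σ = σ * ρ)
    (ε : ℝ) (hε0 : 0 ≤ ε) (hε1 : ε ≤ 1)
    (hdist : trNorm (ρ - σ) ≤ ENNReal.ofReal (2 * ε)) :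
    homExt f (cutAbove ρ ε)
      - ((2 * up a ε + up b ε + a (1 - (trNorm (cutAbove ρ ε)).toReal) : ℝ) : EReal)
      ≤ f σ := by
  have hρs := hS0 hρ
  have hσs := hS0 hσ
  have hρp := (ContinuousLinearMap.nonneg_iff_isPositive ρ).2 hρs.1
  set P := cutAbove ρ ε with hPdef
  have hP : 0 ≤ P := cutAbove_nonneg ρ ε
  have hPσ : P ≤ σ := cutAbove_le_of_trNorm_sub_le hρs hσs hcomm hε0 hdist
  have hPcσ : P * σ = σ * P := Commute.cfc_real hcomm _
  have hPcρ : P * ρ = ρ * P := Commute.cfc_real (Commute.refl ρ) _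
  have hQ : 0 ≤ σ - P := sub_nonneg.2 hPσ
  have htr : trNorm P + trNorm (σ - P) = 1 := by
    rw [← trNorm_add hP hQ, add_sub_cancel, hσs.2]
  have hPfin : trNorm P ≠ ⊤ := fun h => by simp [h] at htr
  have hQfin : trNorm (σ - P) ≠ ⊤ := fun h => by simp [h] at htr
  obtain ⟨ν, hν, hPν, hfP⟩ := exists_mem_eq_smul hSprop f hρ hP (cutAbove_le_self hρp hε0)
    hPcρ.symm hPfin
  obtain ⟨μ, hμ, hQμ, -⟩ := exists_mem_eq_smul hSprop f hσ hQ (sub_le_self σ hP)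
    (by rw [mul_sub, sub_mul, hPcσ]) hQfin
  have htr' : (trNorm P).toReal + (trNorm (σ - P)).toReal = 1 := by
    rw [← ENNReal.toReal_add hPfin hQfin, htr, ENNReal.toReal_one]
  set r := (trNorm P).toReal
  have hr0 : 0 ≤ r := ENNReal.toReal_nonneg
  have hq0 : 0 ≤ (trNorm (σ - P)).toReal := ENNReal.toReal_nonneg
  have hq : (trNorm (σ - P)).toReal = 1 - r := by linarith
  rw [hq] at hQμ hq0
  have hσeq : (1 - r) • μ + (1 - (1 - r)) • ν = σ := by
    rw [← hQμ, sub_sub_cancel, ← hPν, sub_add_cancel]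
  have hL := (hLAA μ hμ ν hν (1 - r) hq0 (by linarith)).1
  rw [hσeq, sub_sub_cancel] at hL
  obtain ⟨hua, hub⟩ := hab.up_nonneg hε0
  rw [hfP]
  refine le_trans (EReal.sub_le_sub ?_ (EReal.coe_le_coe_iff.2 (by linarith))) hL
  exact le_add_of_nonneg_left (mul_nonneg (EReal.coe_nonneg.2 hq0) (hnonneg μ hμ))

end AFW
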